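/- For every integer n ≥ 2, let R be the ℂ-subalgebra of the polynomial ring ℂ[s,t] generated by s, st, st², …, stⁿ, and let J be the ideal of R generated by st, st², …, stⁿ⁻¹. Then the quotient ring R/J is isomorphic, as a ℂ-algebra, to ℂ[x,y]/⟨xy⟩. -/

import Mathlib

open MvPolynomial

noncomputable section

/-- The polynomial ring ℂ[s, t]. -/
abbrev Pst : Type := MvPolynomial (Fin 2) ℂ

/-- `R_n = ℂ[s, st, st², …, stⁿ]`, the coordinate ring of the rational normal cone of
degree `n`, realized as a subalgebra of ℂ[s, t]. -/
def Rn (n : ℕ) : Subalgebra ℂ Pst :=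
  Algebra.adjoin ℂ {p | ∃ i : ℕ, i ≤ n ∧ p = X 0 * X 1 ^ i}

/-- `J = ⟨st, st², …, stⁿ⁻¹⟩`, the radical interior ideal of `R_n`. -/
def Jn (n : ℕ) : Ideal (Rn n) :=
  Ideal.span {x : Rn n | ∃ i : ℕ, 1 ≤ i ∧ i ≤ n - 1 ∧ (x : Pst) = X 0 * X 1 ^ i}

/-- The generator `s tⁱ` of `R_n`. -/
def Rn.gen (n i : ℕ) (hi : i ≤ n) : Rn n :=
  ⟨X 0 * X 1 ^ i, Algebra.subset_adjoin ⟨i, hi, rfl⟩⟩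

theorem X_mul_X_pow_eq_monomial (i : ℕ) :
    (X 0 * X 1 ^ i : Pst) = monomial (Finsupp.single 0 1 + Finsupp.single 1 i) 1 := by
  rw [X_pow_eq_monomial, X, monomial_mul, one_mul]

theorem MvPolynomial.exists_coeff_ne_zero_of_coeff_mul_ne_zero {σ R : Type*} [CommSemiring R]
    {p q : MvPolynomial σ R} {m : σ →₀ ℕ} (h : coeff m (p * q) ≠ 0) :
    ∃ a b, a + b = m ∧ coeff a p ≠ 0 ∧ coeff b q ≠ 0 := by
  classical
  rw [coeff_mul] at h
  obtain ⟨⟨a, b⟩, hab, h⟩ := Finset.exists_ne_zero_of_sum_ne_zero h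
  exact ⟨a, b, Finset.HasAntidiagonal.mem_antidiagonal.mp hab, left_ne_zero_of_mul h, right_ne_zero_of_mul h⟩

theorem MvPolynomial.coeff_ne_zero_or_of_coeff_add_ne_zero {σ R : Type*} [CommSemiring R]
    {p q : MvPolynomial σ R} {m : σ →₀ ℕ} (h : coeff m (p + q) ≠ 0) :
    coeff m p ≠ 0 ∨ coeff m q ≠ 0 := by
  by_contra! hc
  exact h (by rw [coeff_add, hc.1, hc.2, add_zero])

/-- The exponents occurring in elements of `R_n` lie in the cone `b ≤ n a`. -/
theorem Rn.exponent_le {n : ℕ} {p : Pst} (hp : p ∈ Rn n) {m : Fin 2 →₀ ℕ}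
    (hm : coeff m p ≠ 0) : m 1 ≤ n * m 0 := by
  classical
  unfold Rn at hp
  induction hp using Algebra.adjoin_induction generalizing m with
  | mem x hx =>
    obtain ⟨i, hi, rfl⟩ := hx
    rw [X_mul_X_pow_eq_monomial, coeff_monomial] at hm
    obtain rfl := (ite_ne_right_iff.mp hm).1
    simpa using hi
  | algebraMap r =>
    rw [algebraMap_eq, coeff_C] at hm
    obtain rfl := (ite_ne_right_iff.mp hm).1
    simp
  | add x y _ _ hx hy =>
    exact (coeff_ne_zero_or_of_coeff_add_ne_zero hm).elim hx hy
  | mul x y _ _ hx hy =>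
    obtain ⟨a, b, rfl, ha, hb⟩ := exists_coeff_ne_zero_of_coeff_mul_ne_zero hm
    have h₁ := hx ha
    have h₂ := hy hb
    simp only [Finsupp.add_apply, mul_add]
    omega

/-- The exponents occurring in elements of `J` lie in the interior of the cone. -/
theorem Jn.exponent_lt {n : ℕ} {p : Rn n} (hp : p ∈ Jn n) {m : Fin 2 →₀ ℕ}
    (hm : coeff m (p : Pst) ≠ 0) : 0 < m 1 ∧ m 1 < n * m 0 := by
  classical
  unfold Jn at hp
  induction hp using Submodule.span_induction generalizing m with
  | mem x hx =>
    obtain ⟨i, hi, hin, hx⟩ := hx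
    rw [hx, X_mul_X_pow_eq_monomial, coeff_monomial] at hm
    obtain rfl := (ite_ne_right_iff.mp hm).1
    simp
    omega
  | zero => simp at hm
  | add x y _ _ hx hy =>
    exact (coeff_ne_zero_or_of_coeff_add_ne_zero hm).elim hx hy
  | smul r x _ hx =>
    obtain ⟨a, b, rfl, ha, hb⟩ := exists_coeff_ne_zero_of_coeff_mul_ne_zero hm
    have h₁ := Rn.exponent_le r.2 ha
    have h₂ := hx hb
    simp only [Finsupp.add_apply, mul_add]
    omega

/-- The map `ℂ[x, y] → R_n`, `x ↦ s`, `y ↦ s tⁿ`. -/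
def edgeMap (n : ℕ) : MvPolynomial (Fin 2) ℂ →ₐ[ℂ] Rn n :=
  aeval ![Rn.gen n 0 n.zero_le, Rn.gen n n le_rfl]

theorem edgeMap_monomial (n : ℕ) (d : Fin 2 →₀ ℕ) (c : ℂ) :
    (edgeMap n (monomial d c) : Pst) =
      monomial (Finsupp.single 0 (d 0 + d 1) + Finsupp.single 1 (n * d 1)) c := by
  have h : (edgeMap n (monomial d c) : Pst) =
      C c * (X 0 ^ d 0 * (X 0 * X 1 ^ n) ^ d 1) := by
    simp [edgeMap, aeval_monomial, Finsupp.prod_fintype, Rn.gen, algebraMap_eq]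
  rw [h, mul_pow, ← mul_assoc (X 0 ^ d 0), ← pow_add, ← pow_mul, X_pow_eq_monomial,
    X_pow_eq_monomial, monomial_mul, C_mul_monomial]
  simp

theorem coeff_edgeMap {n : ℕ} (hn : n ≠ 0) (f : MvPolynomial (Fin 2) ℂ) (d : Fin 2 →₀ ℕ) :
    coeff (Finsupp.single 0 (d 0 + d 1) + Finsupp.single 1 (n * d 1)) (edgeMap n f : Pst) =
      coeff d f := by
  classical
  induction f using MvPolynomial.induction_on' with
  | monomial e c =>
    rw [edgeMap_monomial, coeff_monomial, coeff_monomial]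
    refine if_congr ⟨fun h => ?_, fun h => h ▸ rfl⟩ rfl rfl
    have h₀ := DFunLike.congr_fun h 0
    have h₁ := DFunLike.congr_fun h 1
    simp [hn] at h₀ h₁
    ext i
    fin_cases i
    · simp; omega
    · simpa using h₁
  | add p q hp hq => rw [map_add, Subalgebra.coe_add, coeff_add, coeff_add, hp, hq]

theorem mem_span_of_edgeMap_mem {n : ℕ} (hn : n ≠ 0) {f : MvPolynomial (Fin 2) ℂ}
    (hf : edgeMap n f ∈ Jn n) : f ∈ Ideal.span {(X 0 * X 1 : MvPolynomial (Fin 2) ℂ)} := by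
  rw [f.as_sum]
  refine Ideal.sum_mem _ fun d hd => ?_
  rw [mem_support_iff, ← coeff_edgeMap hn] at hd
  have h := Jn.exponent_lt hf hd
  simp [mul_add] at h
  have h₁ : d 1 ≠ 0 := by omega
  have h₀ : d 0 ≠ 0 := by omega
  rw [Ideal.mem_span_singleton, ← pow_one (X 1), X_mul_X_pow_eq_monomial, monomial_dvd_monomial]
  refine ⟨Or.inr fun i => ?_, one_dvd _⟩
  fin_cases i <;> simp <;> omega

theorem edgeMap_X_mul_X_mem {n : ℕ} (hn : 2 ≤ n) : edgeMap n (X 0 * X 1) ∈ Jn n := by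
  have h : edgeMap n (X 0 * X 1) =
      Rn.gen n 1 (by omega) * Rn.gen n (n - 1) (by omega) := by
    obtain ⟨k, rfl⟩ := Nat.exists_eq_add_of_le hn
    apply Subtype.ext
    simp [edgeMap, Rn.gen, show 2 + k - 1 = k + 1 by omega]
    ring
  rw [h]
  exact Ideal.mul_mem_right _ _ (Ideal.subset_span ⟨1, le_rfl, by omega, rfl⟩)

theorem mk_edgeMap_surjective (n : ℕ) :
    Function.Surjective ((Ideal.Quotient.mkₐ ℂ (Jn n)).comp (edgeMap n)) := by
  rintro ⟨⟨p, hp⟩⟩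
  change ∃ f, _ = Ideal.Quotient.mkₐ ℂ (Jn n) (⟨p, hp⟩ : Algebra.adjoin ℂ _)
  unfold Rn at hp
  induction hp using Algebra.adjoin_induction with
  | mem x hx =>
    obtain ⟨i, hi, rfl⟩ := hx
    rcases Nat.eq_zero_or_pos i with rfl | hpos
    · exact ⟨X 0, congrArg (Ideal.Quotient.mkₐ ℂ (Jn n)) (aeval_X _ 0)⟩
    rcases hi.eq_or_lt with rfl | hlt
    · exact ⟨X 1, congrArg (Ideal.Quotient.mkₐ ℂ (Jn _)) (aeval_X _ 1)⟩
    · refine ⟨0, ?_⟩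
      rw [map_zero]
      have h : Rn.gen n i hi ∈ Jn n := Ideal.subset_span ⟨i, hpos, by omega, rfl⟩
      exact (Ideal.Quotient.eq_zero_iff_mem.mpr h).symm
  | algebraMap r => exact ⟨algebraMap ℂ _ r, AlgHom.commutes _ r⟩
  | add x y hx hy ihx ihy =>
    obtain ⟨f, hf⟩ := ihx
    obtain ⟨g, hg⟩ := ihy
    exact ⟨f + g, by rw [map_add, hf, hg]; rfl⟩
  | mul x y hx hy ihx ihy =>
    obtain ⟨f, hf⟩ := ihx
    obtain ⟨g, hg⟩ := ihy
    exact ⟨f * g, by rw [map_mul, hf, hg]; rfl⟩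

theorem ker_mk_edgeMap {n : ℕ} (hn : 2 ≤ n) :
    RingHom.ker ((Ideal.Quotient.mkₐ ℂ (Jn n)).comp (edgeMap n)) =
      Ideal.span {(X 0 * X 1 : MvPolynomial (Fin 2) ℂ)} := by
  refine le_antisymm (fun f hf => ?_) ?_
  · exact mem_span_of_edgeMap_mem (by omega) (Ideal.Quotient.eq_zero_iff_mem.mp hf)
  · rw [Ideal.span_singleton_le_iff_mem]
    exact Ideal.Quotient.eq_zero_iff_mem.mpr (edgeMap_X_mul_X_mem hn)

/-- For every `n ≥ 2`, the quotient `R_n / J` is isomorphic as a ℂ-algebra to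
`ℂ[x, y]/⟨xy⟩`, the coordinate ring of the ordinary double point. -/
theorem statement11 (n : ℕ) (hn : 2 ≤ n) :
    Nonempty ((Rn n ⧸ Jn n) ≃ₐ[ℂ]
      (MvPolynomial (Fin 2) ℂ ⧸ Ideal.span {(X 0 * X 1 : MvPolynomial (Fin 2) ℂ)})) := by
  exact ⟨((Ideal.quotientEquivAlgOfEq ℂ (ker_mk_edgeMap hn)).symm.trans
    (Ideal.quotientKerAlgEquivOfSurjective (mk_edgeMap_surjective n))).symm⟩

end
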